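/- arXiv:2012.02701 — 5 statements merged into one kernel-verified Lean document; each statement's English description precedes it below -/
import Mathlib

section
/- Let G be a finite simple graph, let k ≥ 1 be an integer, and set α = 1/k, ℓ = 4k³ + 1, q = 4k⁴. Let W ⊆ V(G) with |W| ≥ q and let Z ⊆ V(G) be a nonempty set with |Z| ≤ k and W ⊆ N[Z]. Then the elements of Z can be enumerated as z_1, …, z_{|Z|} such that for some m ≤ |Z| the sequence (z_1, …, z_m) is a pseudo-cover of W with parameters (α, ℓ, q, k). -/
open Finset

variable {V : Type*}

/-- The closed neighborhood `N[v]` of a vertex as a `Finset`. -/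
def closedNbhd [Fintype V] [DecidableEq V] (G : SimpleGraph V) [DecidableRel G.Adj]
    (v : V) : Finset V :=
  insert v (G.neighborFinset v)

/-- The list `L = (v₁, …, vₘ)` is a pseudo-cover of `W` with parameters `(α, ℓ, q, k)`. -/
def PseudoCover [Fintype V] [DecidableEq V] (G : SimpleGraph V) [DecidableRel G.Adj]
    (α : ℝ) (ℓ q k : ℕ) (W : Finset V) (L : List V) : Prop :=
  L.length ≤ k ∧
  (W \ (L.toFinset.biUnion (closedNbhd G))).card ≤ q ∧
  ∀ i (hi : i < L.length),
    α * (((W \ ((L.take i).toFinset.biUnion (closedNbhd G))).card : ℝ)) ≤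
      (((closedNbhd G (L.get ⟨i, hi⟩)) ∩
        (W \ ((L.take i).toFinset.biUnion (closedNbhd G)))).card : ℝ) ∧
    ℓ ≤ ((closedNbhd G (L.get ⟨i, hi⟩)) ∩
        (W \ ((L.take i).toFinset.biUnion (closedNbhd G)))).card

/-- Some vertex of a cover `Z` of `W` with `|Z| ≤ k` covers at least `|W| / k` of `W`. -/
theorem exists_card_le_mul_card_closedNbhd_inter [Fintype V] [DecidableEq V]
    (G : SimpleGraph V) [DecidableRel G.Adj] {k : ℕ} {W Z : Finset V} (hWne : W.Nonempty)
    (hZk : Z.card ≤ k) (hcov : W ⊆ Z.biUnion (closedNbhd G)) :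
    ∃ z ∈ Z, W.card ≤ k * (closedNbhd G z ∩ W).card := by
  by_contra! h
  have hZne : Z.Nonempty := by
    obtain ⟨w, hw⟩ := hWne
    obtain ⟨z, hz, -⟩ := mem_biUnion.1 (hcov hw)
    exact ⟨z, hz⟩
  have h_card : W.card ≤ ∑ z ∈ Z, (closedNbhd G z ∩ W).card := by
    refine (card_le_card fun w hw => ?_).trans card_biUnion_le
    obtain ⟨z, hz, hwz⟩ := mem_biUnion.1 (hcov hw)
    exact mem_biUnion.2 ⟨z, hz, mem_inter.2 ⟨hwz, hw⟩⟩
  have h_lt := sum_lt_sum_of_nonempty hZne h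
  rw [← mul_sum, sum_const, smul_eq_mul] at h_lt
  have h₁ := Nat.mul_le_mul_left k h_card
  have h₂ := Nat.mul_le_mul_right W.card hZk
  omega

theorem sdiff_biUnion_cons_toFinset [DecidableEq V] (N : V → Finset V) (W : Finset V)
    (z : V) (L : List V) :
    W \ (z :: L).toFinset.biUnion N = (W \ N z) \ L.toFinset.biUnion N := by
  rw [List.toFinset_cons, biUnion_insert, sdiff_sdiff_left, sup_eq_union]

theorem PseudoCover.cons [Fintype V] [DecidableEq V] {G : SimpleGraph V}
    [DecidableRel G.Adj] {α : ℝ} {ℓ q k : ℕ} {W : Finset V} {z : V} {L : List V}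
    (hL : PseudoCover G α ℓ q k (W \ closedNbhd G z) L) (h_len : L.length + 1 ≤ k)
    (h_strong : α * (W.card : ℝ) ≤ ((closedNbhd G z ∩ W).card : ℝ))
    (h_large : ℓ ≤ (closedNbhd G z ∩ W).card) :
    PseudoCover G α ℓ q k W (z :: L) := by
  obtain ⟨-, h_rest, h_steps⟩ := hL
  refine ⟨by simpa using h_len, ?_, ?_⟩
  · rwa [sdiff_biUnion_cons_toFinset]
  · rintro (_ | i) hi
    · simpa using ⟨h_strong, h_large⟩
    · simp only [List.take_succ_cons, sdiff_biUnion_cons_toFinset]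
      exact h_steps i (by simpa using hi)

/-- The greedy choice of vertices from a cover `Z` of `W` yields a pseudo-cover of `W`. -/
theorem exists_pseudoCover_of_cover [Fintype V] [DecidableEq V] (G : SimpleGraph V)
    [DecidableRel G.Adj] {k c : ℕ} (hk : 1 ≤ k) {W Z : Finset V} (hZk : Z.card ≤ k)
    (hcov : W ⊆ Z.biUnion (closedNbhd G)) :
    ∃ L : List V, L.Nodup ∧ L.toFinset ⊆ Z ∧
      PseudoCover G (1 / (k : ℝ)) (c + 1) (k * c) k W L := by
  induction Z using Finset.strongInduction generalizing W with
  | H Z ih =>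
    by_cases hWq : W.card ≤ k * c
    · exact ⟨[], by simp, by simp, by simp, by simpa using hWq, by simp⟩
    push Not at hWq
    obtain ⟨z, hz, hWz⟩ := exists_card_le_mul_card_closedNbhd_inter G
      (card_pos.1 (by omega)) hZk hcov
    obtain ⟨L, h_nodup, h_sub, hL⟩ := ih (Z.erase z) (erase_ssubset hz)
      ((card_le_card (erase_subset z Z)).trans hZk) (W := W \ closedNbhd G z) (by
        intro w hw
        rw [mem_sdiff] at hw
        obtain ⟨y, hy, hwy⟩ := mem_biUnion.1 (hcov hw.1)
        refine mem_biUnion.2 ⟨y, mem_erase.2 ⟨?_, hy⟩, hwy⟩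
        rintro rfl
        exact hw.2 hwy)
    have hzL : z ∉ L := fun h => by simpa using h_sub (List.mem_toFinset.2 h)
    have h_sub' : (z :: L).toFinset ⊆ Z := by
      rw [List.toFinset_cons]
      exact insert_subset hz (h_sub.trans (erase_subset z Z))
    have h_nodup' : (z :: L).Nodup := List.nodup_cons.2 ⟨hzL, h_nodup⟩
    refine ⟨z :: L, h_nodup', h_sub', hL.cons ?_ ?_ ?_⟩
    · have := card_le_card h_sub'
      rw [List.toFinset_card_of_nodup h_nodup', List.length_cons] at this
      exact this.trans hZk
    · rw [one_div, inv_mul_le_iff₀ (by exact_mod_cast hk)]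
      exact_mod_cast hWz
    · exact Nat.lt_of_mul_lt_mul_left (hWq.trans_le hWz)

/-- from a cover `Z` of `W` (with `|Z| ≤ k`, `Z` nonempty, `|W| ≥ q = 4k⁴`)
one can enumerate `Z` as `z₁, …, z_{|Z|}` so that some prefix `(z₁, …, zₘ)` is a
pseudo-cover of `W` with parameters `(1/k, 4k³+1, 4k⁴, k)`. -/
theorem stmt2 [Fintype V] [DecidableEq V] (G : SimpleGraph V) [DecidableRel G.Adj]
    (k : ℕ) (hk : 1 ≤ k) (W Z : Finset V)
    (hW : 4 * k ^ 4 ≤ W.card) (hZne : Z.Nonempty) (hZk : Z.card ≤ k)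
    (hcov : W ⊆ Z.biUnion (closedNbhd G)) :
    ∃ L : List V, L.Nodup ∧ L.toFinset = Z ∧
      ∃ m ≤ L.length,
        PseudoCover G (1 / (k : ℝ)) (4 * k ^ 3 + 1) (4 * k ^ 4) k W (L.take m) := by
  obtain ⟨P, h_nodup, h_sub, hP⟩ :=
    exists_pseudoCover_of_cover G (c := 4 * k ^ 3) hk hZk hcov
  refine ⟨P ++ (Z \ P.toFinset).toList, ?_, ?_, P.length, by simp, ?_⟩
  · refine h_nodup.append (nodup_toList _) fun v hv hv' => ?_
    simp [hv] at hv'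
  · rw [List.toFinset_append, toList_toFinset, union_sdiff_of_subset h_sub]
  · rw [List.take_left]
    convert hP using 1
    ring
end

section
/- Let G be a finite simple graph, let c > 0 be a real number such that G has 1-shallow-minor density at most c, let k ≥ 2 be an integer with k ≥ 2c, and set α = 1/k, ℓ = 4k³ + 1, q = 4k⁴. Then for every set W ⊆ V(G) with |W| ≥ ℓ, the number of distinct sequences that are pseudo-covers of W with parameters (α, ℓ, q, k) is at most 2·(2k²)^k. -/
open Finset

variable {V : Type*}

/-- `H` (on vertex set `Fin n`) is a 1-shallow minor of `G`: there are pairwise disjoint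
branch sets, each inducing a connected subgraph of radius at most 1 (i.e. having a center
adjacent to all its other vertices), such that edges of `H` are realized by edges of `G`
between the corresponding branch sets. -/
def IsOneShallowMinor (G : SimpleGraph V) {n : ℕ} (H : SimpleGraph (Fin n)) : Prop :=
  ∃ B : Fin n → Finset V,
    (∀ i, ∃ c ∈ B i, ∀ w ∈ B i, w = c ∨ G.Adj c w) ∧
    (∀ i j, i ≠ j → Disjoint (B i) (B j)) ∧
    (∀ i j, H.Adj i j → ∃ a ∈ B i, ∃ b ∈ B j, G.Adj a b)

/-- `G` has 1-shallow-minor density at most `c`: every 1-shallow minor `H` of `G`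
satisfies `|E(H)| ≤ c * |V(H)|`. -/
def DensityOneLE (G : SimpleGraph V) (c : ℝ) : Prop :=
  ∀ (n : ℕ) (H : SimpleGraph (Fin n)), IsOneShallowMinor G H →
    (Nat.card H.edgeSet : ℝ) ≤ c * n

/-- Bounded 1-shallow-minor density bounds the number of edges leaving `Z` inside `S`. -/
theorem DensityOneLE.card_pairs_le [DecidableEq V] {G : SimpleGraph V} {c : ℝ}
    (hdens : DensityOneLE G c) (S Z : Finset V) (P : Finset (V × V))
    (hP : ∀ p ∈ P, p.1 ∈ S ∧ p.2 ∈ S ∧ p.1 ∈ Z ∧ p.2 ∉ Z ∧ G.Adj p.1 p.2) :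
    (P.card : ℝ) ≤ c * S.card := by
  let e := S.equivFin
  let H : SimpleGraph (Fin S.card) := G.comap (fun i => (e.symm i : V))
  have hminor : IsOneShallowMinor G H := by
    refine ⟨fun i => {(e.symm i : V)}, fun i => ⟨_, mem_singleton_self _, ?_⟩, ?_, ?_⟩
    · intro w hw
      exact Or.inl (mem_singleton.1 hw)
    · intro i j hij
      rw [disjoint_singleton]
      exact fun h => hij (e.symm.injective (Subtype.ext h))
    · intro i j hij
      exact ⟨_, mem_singleton_self _, _, mem_singleton_self _, hij⟩
  refine le_trans ?_ (hdens _ H hminor)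
  let f : P → H.edgeSet := fun p =>
    ⟨s(e ⟨p.1.1, (hP p.1 p.2).1⟩, e ⟨p.1.2, (hP p.1 p.2).2.1⟩), by
      simpa [H] using (hP p.1 p.2).2.2.2.2⟩
  have hf : Function.Injective f := by
    rintro ⟨⟨a, b⟩, hp⟩ ⟨⟨a', b'⟩, hp'⟩ h
    have ha := hP _ hp
    have hb := hP _ hp'
    simp only [f, Subtype.mk.injEq, Sym2.eq_iff, EmbeddingLike.apply_eq_iff_eq] at h
    rcases h with ⟨h1, h2⟩ | ⟨h1, h2⟩
    · simp [h1, h2]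
    · exact absurd (h1 ▸ ha.2.2.1) hb.2.2.2.1
  have := Nat.card_le_card_of_injective f hf
  rw [Nat.card_eq_fintype_card, Fintype.card_coe] at this
  exact_mod_cast this

/-- A large set `W` has fewer than `2k²` vertices that are `1/k`-strong for it. -/
theorem DensityOneLE.card_strong_le [Fintype V] [DecidableEq V] {G : SimpleGraph V}
    [DecidableRel G.Adj] {c : ℝ} (hdens : DensityOneLE G c) {k : ℕ} (hk : 2 ≤ k)
    (hkc : 2 * c ≤ (k : ℝ)) {W : Finset V} (hW : 4 * k ^ 3 + 1 ≤ W.card) {Z : Finset V}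
    (hZ : ∀ z ∈ Z, 1 / (k : ℝ) * (W.card : ℝ) ≤ ((closedNbhd G z ∩ W).card : ℝ)) :
    Z.card ≤ 2 * k ^ 2 := by
  by_contra! hlt
  obtain ⟨Y, hYZ, hY⟩ := exists_subset_card_eq hlt.le
  have hP := hdens.card_pairs_le (Y ∪ W) Y
    ((Y ×ˢ (W \ Y)).filter fun p => G.Adj p.1 p.2) (by
      rintro ⟨a, b⟩ h
      simp only [mem_filter, mem_product, mem_sdiff] at h
      simp [h])
  have hcard : ((Y ×ˢ (W \ Y)).filter fun p => G.Adj p.1 p.2).card =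
      ∑ z ∈ Y, ((W \ Y).filter fun w => G.Adj z w).card := by
    simp only [card_filter, sum_product]
  have hk0 : (0 : ℝ) < k := by positivity
  have hdeg : ∀ z ∈ Y, 1 / (k : ℝ) * W.card - 2 * k ^ 2 ≤
      (((W \ Y).filter fun w => G.Adj z w).card : ℝ) := by
    intro z hz
    have hsub : closedNbhd G z ∩ W ⊆ ((W \ Y).filter fun w => G.Adj z w) ∪ Y := by
      intro w hw
      simp only [closedNbhd, mem_inter, mem_insert, SimpleGraph.mem_neighborFinset] at hw
      simp only [mem_union, mem_filter, mem_sdiff]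
      by_cases hwY : w ∈ Y
      · exact Or.inr hwY
      · rcases hw with ⟨rfl | h, hwW⟩
        · exact absurd hz hwY
        · exact Or.inl ⟨⟨hwW, hwY⟩, h⟩
    have h1 := (card_le_card hsub).trans (card_union_le _ _)
    rw [hY] at h1
    have h2 : ((closedNbhd G z ∩ W).card : ℝ) ≤
        (((W \ Y).filter fun w => G.Adj z w).card : ℝ) + 2 * k ^ 2 := by exact_mod_cast h1
    linarith [hZ z (hYZ hz)]
  have hsum := card_nsmul_le_sum Y
    (fun z => (((W \ Y).filter fun w => G.Adj z w).card : ℝ)) _ hdeg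
  rw [hY, nsmul_eq_mul, ← Nat.cast_sum, ← hcard] at hsum
  push_cast at hsum
  have hunion : ((Y ∪ W).card : ℝ) ≤ 2 * k ^ 2 + W.card := by
    have := card_union_le Y W
    rw [hY] at this
    exact_mod_cast this
  have hup : c * ((Y ∪ W).card : ℝ) ≤ k / 2 * (2 * k ^ 2 + W.card) :=
    (mul_le_mul_of_nonneg_right (by linarith : c ≤ k / 2) (by positivity)).trans
      (mul_le_mul_of_nonneg_left hunion (by positivity))
  have hWr : 4 * (k : ℝ) ^ 3 + 1 ≤ W.card := by exact_mod_cast hW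
  have hkr : (2 : ℝ) ≤ k := by exact_mod_cast hk
  have hlow : 2 * (k : ℝ) ^ 2 * (1 / k * W.card - 2 * k ^ 2) =
      k * (2 * W.card - 4 * k ^ 3) := by
    field_simp
    ring
  rw [hlow] at hsum
  have hmul : (k : ℝ) * (2 * W.card - 4 * k ^ 3) ≤ k * ((2 * k ^ 2 + W.card) / 2) := by
    linarith
  have := le_of_mul_le_mul_left hmul hk0
  nlinarith [sq_nonneg (k : ℝ), mul_le_mul_of_nonneg_left hkr (sq_nonneg (k : ℝ))]

/-- If every set has at most `N` greedy choices, then there are at most `N ^ m` greedy sequences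
of length `m`. -/
theorem exists_finset_greedy_sequences [DecidableEq V] (A : V → Finset V)
    (R : Finset V → V → Prop) (N : ℕ)
    (hR : ∀ U, ∃ Z : Finset V, Z.card ≤ N ∧ ∀ v, R U v → v ∈ Z) (m : ℕ) (W : Finset V) :
    ∃ F : Finset (List V), F.card ≤ N ^ m ∧ ∀ L : List V, L.length = m →
      (∀ i (hi : i < L.length), R (W \ (L.take i).toFinset.biUnion A) (L.get ⟨i, hi⟩)) →
      L ∈ F := by
  induction m generalizing W with
  | zero => exact ⟨{[]}, by simp, fun L hL _ => by simp [List.length_eq_zero_iff.1 hL]⟩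
  | succ m ih =>
    choose F hF hmem using ih
    obtain ⟨Z, hZ, hRZ⟩ := hR W
    refine ⟨Z.biUnion fun v => (F (W \ A v)).image (List.cons v), ?_, ?_⟩
    · refine (card_biUnion_le_card_mul _ _ (N ^ m)
        fun v _ => card_image_le.trans (hF _)).trans ?_
      rw [pow_succ']
      exact Nat.mul_le_mul_right _ hZ
    · rintro (_ | ⟨v, L⟩) hL h
      · simp at hL
      · simp only [mem_biUnion, mem_image]
        refine ⟨v, hRZ v (by simpa using h 0 (by simp)), L,
          hmem _ L (by simpa using hL) fun i hi => ?_, rfl⟩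
        have := h (i + 1) (by simpa using hi)
        simpa [biUnion_insert, sdiff_sdiff_left] using this

theorem sum_range_succ_pow_le {N : ℕ} (hN : 2 ≤ N) (k : ℕ) :
    ∑ m ∈ range (k + 1), N ^ m ≤ 2 * N ^ k := by
  induction k with
  | zero => simp
  | succ k ih =>
    rw [sum_range_succ, pow_succ]
    nlinarith [Nat.mul_le_mul_left (N ^ k) hN]

/-- if `G` has 1-shallow-minor density at most `c > 0`, `k ≥ 2`, `k ≥ 2c`,
then for every `W` with `|W| ≥ ℓ = 4k³+1` the number of pseudo-covers of `W` (with
parameters `(1/k, 4k³+1, 4k⁴, k)`) is at most `2·(2k²)^k`. -/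
theorem stmt4 [Fintype V] [DecidableEq V] (G : SimpleGraph V) [DecidableRel G.Adj]
    (c : ℝ) (hc : 0 < c) (hdens : DensityOneLE G c)
    (k : ℕ) (hk : 2 ≤ k) (hkc : 2 * c ≤ (k : ℝ))
    (W : Finset V) (hW : 4 * k ^ 3 + 1 ≤ W.card) :
    {L : List V | PseudoCover G (1 / (k : ℝ)) (4 * k ^ 3 + 1) (4 * k ^ 4) k W L}.Finite ∧
    {L : List V | PseudoCover G (1 / (k : ℝ)) (4 * k ^ 3 + 1) (4 * k ^ 4) k W L}.ncard ≤
      2 * (2 * k ^ 2) ^ k := by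
  classical
  have hR : ∀ U : Finset V, ∃ Z : Finset V, Z.card ≤ 2 * k ^ 2 ∧ ∀ v,
      (1 / (k : ℝ) * (U.card : ℝ) ≤ ((closedNbhd G v ∩ U).card : ℝ) ∧
        4 * k ^ 3 + 1 ≤ (closedNbhd G v ∩ U).card) → v ∈ Z := by
    intro U
    by_cases hU : 4 * k ^ 3 + 1 ≤ U.card
    · exact ⟨univ.filter fun v => 1 / (k : ℝ) * (U.card : ℝ) ≤ ((closedNbhd G v ∩ U).card : ℝ),
        hdens.card_strong_le hk hkc hU fun z hz => (mem_filter.1 hz).2,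
        fun v hv => mem_filter.2 ⟨mem_univ v, hv.1⟩⟩
    · exact ⟨∅, by simp, fun v hv =>
        absurd (hv.2.trans (card_le_card inter_subset_right)) hU⟩
  choose F hF hmem using fun m =>
    exists_finset_greedy_sequences (closedNbhd G) _ (2 * k ^ 2) hR m W
  have hsub : {L : List V | PseudoCover G (1 / (k : ℝ)) (4 * k ^ 3 + 1) (4 * k ^ 4) k W L} ⊆
      ↑((range (k + 1)).biUnion F) := fun L hL =>
    mem_coe.2 (mem_biUnion.2
      ⟨L.length, mem_range.2 (Nat.lt_succ_of_le hL.1), hmem _ L rfl hL.2.2⟩)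
  refine ⟨(finite_toSet _).subset hsub, ?_⟩
  refine (Set.ncard_le_ncard hsub (finite_toSet _)).trans ?_
  rw [Set.ncard_coe_finset]
  exact card_biUnion_le.trans ((sum_le_sum fun m _ => hF m).trans
    (sum_range_succ_pow_le (by nlinarith) k))
end

section
/- Let G be a finite simple graph, let t ≥ 1 and k ≥ 1 be integers such that G contains no K_{t,t} subgraph, and let D' ⊆ V(G) have the k-cover property. Call a sequence (v_1,…,v_s) of pairwise distinct vertices a greedy sequence if, setting B_1 = N(v_1) and B_{i+1} = N(v_{i+1}) ∩ B_i, for every 1 ≤ i < s we have |N[v_{i+1}] ∩ B_i| ≥ k^{t−i−1}·(2t−i); call it maximal if no vertex u ∉ {v_1,…,v_s} satisfies |N[u] ∩ B_s| ≥ k^{t−s−1}·(2t−s). If |N(v_1)| ≥ k^{t−1}·(2t−1) and (v_1,…,v_s) is a maximal greedy sequence, then s < t and {v_1,…,v_s} ∩ D' ≠ ∅. -/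
open Finset

variable {V : Type*}

/-- `G` contains `K_{t,t}` as a subgraph. -/
def HasKtt (G : SimpleGraph V) (t : ℕ) : Prop :=
  ∃ A B : Finset V, Disjoint A B ∧ A.card = t ∧ B.card = t ∧
    ∀ a ∈ A, ∀ b ∈ B, G.Adj a b

/-- `D'` has the `k`-cover property: for every vertex `v` there is `Z ⊆ D' \\ {v}`
with `|Z| ≤ k` and `N(v) ⊆ N[Z]`. -/
def KCoverProp [Fintype V] [DecidableEq V] (G : SimpleGraph V) [DecidableRel G.Adj]
    (D' : Finset V) (k : ℕ) : Prop :=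
  ∀ v : V, ∃ Z : Finset V, Z ⊆ D'.erase v ∧ Z.card ≤ k ∧
    G.neighborFinset v ⊆ Z.biUnion (closedNbhd G)

/-- Iterated intersection of open neighborhoods: `interN G (v₁, …, vᵢ) = N(v₁) ∩ ⋯ ∩ N(vᵢ)`,
so that for a greedy sequence, `Bᵢ = interN G (v₁, …, vᵢ)`. -/
def interN [Fintype V] [DecidableEq V] (G : SimpleGraph V) [DecidableRel G.Adj]
    (L : List V) : Finset V :=
  L.foldr (fun v s => G.neighborFinset v ∩ s) Finset.univ

theorem mem_interN [Fintype V] [DecidableEq V] (G : SimpleGraph V) [DecidableRel G.Adj]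
    (L : List V) (x : V) : x ∈ interN G L ↔ ∀ w ∈ L, G.Adj w x := by
  induction L with
  | nil => simp [interN]
  | cons a L ih =>
    have h : interN G (a :: L) = G.neighborFinset a ∩ interN G L := rfl
    simp [h, ih]

/-- A list of distinct vertices with many common neighbors yields a `K_{t,t}`. -/
theorem HasKtt.of_le_card_interN [Fintype V] [DecidableEq V] (G : SimpleGraph V)
    [DecidableRel G.Adj] {t : ℕ} {L : List V} (hL : L.Nodup) (hlen : L.length = t)
    (hcard : t ≤ (interN G L).card) : HasKtt G t := by
  obtain ⟨B, hB, hBt⟩ := exists_subset_card_eq hcard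
  have hadj : ∀ a ∈ L.toFinset, ∀ b ∈ B, G.Adj a b := fun a ha b hb =>
    (mem_interN G L b).1 (hB hb) a (List.mem_toFinset.1 ha)
  refine ⟨L.toFinset, B, ?_, by rw [List.toFinset_card_of_nodup hL, hlen], hBt, hadj⟩
  exact Finset.disjoint_left.2 fun a ha hb => G.irrefl (hadj a ha a hb)

/-- Appending a vertex to a list shrinks the common neighborhood to its trace on the closed
neighborhood of that vertex, up to one element. -/
theorem card_closedNbhd_inter_interN_le [Fintype V] [DecidableEq V] (G : SimpleGraph V)
    [DecidableRel G.Adj] (L : List V) (x : V) :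
    (closedNbhd G x ∩ interN G L).card ≤ (interN G (L ++ [x])).card + 1 := by
  refine (card_le_card ?_).trans (card_insert_le x _)
  intro y hy
  simp only [closedNbhd, mem_inter, mem_insert, SimpleGraph.mem_neighborFinset, mem_interN,
    List.mem_append, List.mem_singleton] at hy ⊢
  grind

/-- If `D'` has the `k`-cover property, then any set of at least `k * m` neighbors of a vertex
has `m` elements in the closed neighborhood of a single vertex of `D'`. -/
theorem KCoverProp.exists_le_card_inter [Fintype V] [DecidableEq V] {G : SimpleGraph V}
    [DecidableRel G.Adj] {D' : Finset V} {k m : ℕ} (hD' : KCoverProp G D' k) (hk : 1 ≤ k)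
    (hm : 1 ≤ m) {v : V} {B : Finset V} (hB : B ⊆ G.neighborFinset v) (hcard : k * m ≤ B.card) :
    ∃ z ∈ D', m ≤ (closedNbhd G z ∩ B).card := by
  obtain ⟨Z, hZ, hZk, hcov⟩ := hD' v
  by_contra! hlt
  have hsub : B ⊆ Z.biUnion fun z => closedNbhd G z ∩ B := by
    intro x hx
    obtain ⟨z, hz, hxz⟩ := mem_biUnion.1 (hcov (hB hx))
    exact mem_biUnion.2 ⟨z, hz, mem_inter.2 ⟨hxz, hx⟩⟩
  have hle : B.card ≤ Z.card * (m - 1) := (card_le_card hsub).trans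
    (card_biUnion_le_card_mul _ _ _ fun z hz =>
      Nat.le_sub_one_of_lt (hlt z (mem_of_mem_erase (hZ hz))))
  have hlast : k * (m - 1) < k * m := Nat.mul_lt_mul_of_pos_left (by omega) hk
  exact absurd (hcard.trans (hle.trans (Nat.mul_le_mul_right _ hZk))) hlast.not_ge

/-- in a `K_{t,t}`-free graph, if `D'` has the `k`-cover property and
`(v₁, …, v_s) = v :: L` is a maximal greedy sequence of pairwise distinct vertices
(with `B₁ = N(v₁)`, `B_{i+1} = N(v_{i+1}) ∩ B_i`, and
`|N[v_{i+1}] ∩ B_i| ≥ k^(t-i-1)·(2t-i)` for `1 ≤ i < s`), and `|N(v₁)| ≥ k^(t-1)·(2t-1)`,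
then `s < t` and `{v₁, …, v_s} ∩ D' ≠ ∅`. -/
theorem stmt7 [Fintype V] [DecidableEq V] (G : SimpleGraph V) [DecidableRel G.Adj]
    (t k : ℕ) (ht : 1 ≤ t) (hk : 1 ≤ k)
    (hKtt : ¬ HasKtt G t)
    (D' : Finset V) (hD' : KCoverProp G D' k)
    (v : V) (L : List V) (hnd : (v :: L).Nodup)
    (hgreedy : ∀ i (hi : i < (v :: L).length), 1 ≤ i →
      k ^ (t - i - 1) * (2 * t - i) ≤
        (closedNbhd G ((v :: L).get ⟨i, hi⟩) ∩ interN G ((v :: L).take i)).card)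
    (hmax : ¬ ∃ u : V, u ∉ (v :: L) ∧
      k ^ (t - (v :: L).length - 1) * (2 * t - (v :: L).length) ≤
        (closedNbhd G u ∩ interN G (v :: L)).card)
    (hbig : k ^ (t - 1) * (2 * t - 1) ≤ (G.neighborFinset v).card) :
    (v :: L).length < t ∧ ∃ w ∈ (v :: L), w ∈ D' := by
  have hB : ∀ i, 1 ≤ i → i ≤ (v :: L).length → i ≤ t →
      k ^ (t - i) * (2 * t - i) ≤ (interN G ((v :: L).take i)).card := by
    intro i hi
    induction i, hi using Nat.le_induction with
    | base => intro _ _; simpa [interN] using hbig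
    | succ i hi ih =>
      intro hlen hit
      have hstep := (hgreedy i hlen hi).trans (card_closedNbhd_inter_interN_le G _ _)
      rw [List.get_eq_getElem, List.take_append_getElem hlen] at hstep
      have hpow : 1 ≤ k ^ (t - i - 1) := Nat.one_le_pow _ _ hk
      have hsucc : 2 * t - i = (2 * t - (i + 1)) + 1 := by omega
      rw [hsucc, Nat.mul_succ] at hstep
      rw [← Nat.sub_sub t i 1]
      omega
  have hs : (v :: L).length < t := by
    by_contra! hts
    have hBt := hB t ht hts le_rfl
    refine hKtt (HasKtt.of_le_card_interN G (hnd.sublist (List.take_sublist t _))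
      (List.length_take_of_le hts) ?_)
    rw [Nat.sub_self, pow_zero, one_mul] at hBt
    omega
  refine ⟨hs, ?_⟩
  have hBs := hB (v :: L).length (by simp) le_rfl hs.le
  rw [List.take_length, show t - (v :: L).length = t - (v :: L).length - 1 + 1 by omega,
    pow_succ', mul_assoc] at hBs
  have hsub : interN G (v :: L) ⊆ G.neighborFinset v := fun x hx =>
    (G.mem_neighborFinset v x).2 ((mem_interN G _ x).1 hx v List.mem_cons_self)
  obtain ⟨z, hz, hcard⟩ := hD'.exists_le_card_inter hk
    (Nat.mul_pos (pow_pos hk _) (by omega)) hsub hBs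
  exact ⟨z, by_contra fun hzL => hmax ⟨z, hzL, hcard⟩, hz⟩
end

section
/- Let G be a finite simple graph, let t ≥ 1 and k ≥ 2 be integers such that G contains no K_{t,t} subgraph, let c > 0 be a real with k ≥ 2c such that G has 1-shallow-minor density at most c, set α = 1/k, ℓ = 4k³ + 1, q = 4k⁴, and let D' ⊆ V(G) have the k-cover property. Then for every maximal k-dominating-sequence (v_1,…,v_s) of any vertex and every 1 ≤ i ≤ s−1: v_{i+1} ∈ 𝒫(v_i), |N(v_i)| > ℓ, and |𝒫(v_i)| ≤ (2k)^{2k+1}. -/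
open Finset

variable {V : Type*}

/-- `𝒫(v)`: the set of vertices appearing in some pseudo-cover of `N(v)`,
when `|N(v)| > ℓ`, and `∅` otherwise. -/
def PCov [Fintype V] [DecidableEq V] (G : SimpleGraph V) [DecidableRel G.Adj]
    (α : ℝ) (ℓ q k : ℕ) (v : V) : Set V :=
  {u | ℓ < (G.neighborFinset v).card ∧
    ∃ L : List V, PseudoCover G α ℓ q k (G.neighborFinset v) L ∧ u ∈ L}

/-- `(vs 1, …, vs s)` is a `k`-dominating-sequence of `v` (with parameters
`α, ℓ, q, k, t`): the vertices are pairwise distinct, `vs 1 = v`, and there are sets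
`B 1, …, B s` with `B 1 ⊆ N(vs 1)`, `B i ⊆ N(vs i) ∩ B (i-1)`,
`|B i| ≥ k^(t-i) * (2t - i + (t-i)q)` and `vs i ∈ 𝒫(vs (i-1))`. -/
def KDomSeq [Fintype V] [DecidableEq V] (G : SimpleGraph V) [DecidableRel G.Adj]
    (α : ℝ) (ℓ q k t : ℕ) (v : V) (s : ℕ) (vs : ℕ → V) : Prop :=
  1 ≤ s ∧ vs 1 = v ∧
  (∀ i j, 1 ≤ i → i < j → j ≤ s → vs i ≠ vs j) ∧
  ∃ B : ℕ → Finset V,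
    B 1 ⊆ G.neighborFinset (vs 1) ∧
    (∀ i, 2 ≤ i → i ≤ s → B i ⊆ G.neighborFinset (vs i) ∩ B (i - 1)) ∧
    (∀ i, 1 ≤ i → i ≤ s → k ^ (t - i) * (2 * t - i + (t - i) * q) ≤ (B i).card) ∧
    (∀ i, 2 ≤ i → i ≤ s → vs i ∈ PCov G α ℓ q k (vs (i - 1)))

/-- A maximal `k`-dominating-sequence: one that cannot be extended by any vertex. -/
def MaxKDomSeq [Fintype V] [DecidableEq V] (G : SimpleGraph V) [DecidableRel G.Adj]
    (α : ℝ) (ℓ q k t : ℕ) (v : V) (s : ℕ) (vs : ℕ → V) : Prop :=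
  KDomSeq G α ℓ q k t v s vs ∧
  ¬ ∃ u : V, KDomSeq G α ℓ q k t v (s + 1) (Function.update vs (s + 1) u)

/-- Induced subgraphs are 1-shallow minors, so their average degree is bounded by twice the
1-shallow-minor density. -/
theorem DensityOneLE.sum_card_neighborFinset_inter_le [Fintype V] [DecidableEq V]
    {G : SimpleGraph V} [DecidableRel G.Adj] {c : ℝ} (h : DensityOneLE G c) (S : Finset V) :
    (∑ v ∈ S, ((G.neighborFinset v ∩ S).card : ℝ)) ≤ 2 * c * S.card := by
  classical
  let e : Fin S.card ≃ S := S.equivFin.symm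
  let H : SimpleGraph (Fin S.card) := G.comap (fun i => (e i : V))
  have hinj : Function.Injective (fun i => (e i : V)) := Subtype.val_injective.comp e.injective
  have hH : IsOneShallowMinor G H := by
    refine ⟨fun i => {(e i : V)}, fun i => ⟨e i, by simp⟩, fun i j hij => ?_, fun i j hij => ?_⟩
    · rw [Finset.disjoint_singleton]
      exact hinj.ne hij
    · exact ⟨e i, by simp, e j, by simp, hij⟩
  have hdeg (i : Fin S.card) : H.degree i = (G.neighborFinset (e i) ∩ S).card := by
    rw [← SimpleGraph.card_neighborFinset_eq_degree,
      ← Finset.card_image_of_injective _ hinj]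
    congr 1
    ext x
    simp only [Finset.mem_image, SimpleGraph.mem_neighborFinset, Finset.mem_inter]
    constructor
    · rintro ⟨j, hj, rfl⟩
      exact ⟨hj, (e j).2⟩
    · rintro ⟨hx, hxS⟩
      refine ⟨e.symm ⟨x, hxS⟩, ?_, by simp⟩
      simpa [H] using hx
  have hsum : ∑ v ∈ S, (G.neighborFinset v ∩ S).card = 2 * H.edgeFinset.card := by
    rw [← H.sum_degrees_eq_twice_card_edges, ← Finset.sum_coe_sort S]
    simp only [hdeg]
    exact (Equiv.sum_comp e fun x : S => (G.neighborFinset (x : V) ∩ S).card).symm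
  have hcard := h _ H hH
  rw [Nat.card_eq_fintype_card, ← SimpleGraph.edgeFinset_card] at hcard
  rw [← Nat.cast_sum, hsum]
  push_cast
  linarith

/-- The `α`-strong vertices for `W` whose closed neighborhood contains at least `ℓ`
elements of `W`. -/
noncomputable def strongVertices [Fintype V] [DecidableEq V] (G : SimpleGraph V)
    [DecidableRel G.Adj] (α : ℝ) (ℓ : ℕ) (W : Finset V) : Finset V :=
  {z | α * (W.card : ℝ) ≤ ((closedNbhd G z ∩ W).card : ℝ) ∧ ℓ ≤ (closedNbhd G z ∩ W).card}

theorem card_strongVertices_le [Fintype V] [DecidableEq V] {G : SimpleGraph V}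
    [DecidableRel G.Adj] {c : ℝ} {k : ℕ} (hk : 2 ≤ k) (hkc : 2 * c ≤ (k : ℝ))
    (hdens : DensityOneLE G c) (W : Finset V) :
    (strongVertices G (1 / (k : ℝ)) (4 * k ^ 3 + 1) W).card ≤ (2 * k) ^ 2 := by
  set Z := strongVertices G (1 / (k : ℝ)) (4 * k ^ 3 + 1) W with hZ
  obtain hZ0 | ⟨z₀, hz₀⟩ := Z.eq_empty_or_nonempty
  · simp [hZ0]
  have hW : 4 * k ^ 3 + 1 ≤ W.card := by
    rw [hZ, strongVertices, Finset.mem_filter] at hz₀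
    exact hz₀.2.2.trans (Finset.card_le_card Finset.inter_subset_right)
  have hlow : ∀ z ∈ Z, 1 / (k : ℝ) * W.card - 1 ≤
      ((G.neighborFinset z ∩ (Z ∪ W)).card : ℝ) := by
    intro z hz
    rw [hZ, strongVertices, Finset.mem_filter] at hz
    have hsub : closedNbhd G z ∩ W ⊆ insert z (G.neighborFinset z ∩ (Z ∪ W)) := by
      intro x
      simp only [closedNbhd, Finset.mem_inter, Finset.mem_insert, Finset.mem_union]
      tauto
    have hle : ((closedNbhd G z ∩ W).card : ℝ) ≤
        ((G.neighborFinset z ∩ (Z ∪ W)).card : ℝ) + 1 := by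
      exact_mod_cast (Finset.card_le_card hsub).trans (Finset.card_insert_le _ _)
    linarith [hz.2.1]
  have hsum : (Z.card : ℝ) * (1 / (k : ℝ) * W.card - 1) ≤ k * (Z.card + W.card) := by
    calc (Z.card : ℝ) * (1 / (k : ℝ) * W.card - 1)
        ≤ ∑ z ∈ Z, ((G.neighborFinset z ∩ (Z ∪ W)).card : ℝ) := by
          rw [← nsmul_eq_mul]
          exact Finset.card_nsmul_le_sum _ _ _ hlow
      _ ≤ ∑ z ∈ Z ∪ W, ((G.neighborFinset z ∩ (Z ∪ W)).card : ℝ) :=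
          Finset.sum_le_sum_of_subset_of_nonneg Finset.subset_union_left
            fun _ _ _ => Nat.cast_nonneg _
      _ ≤ 2 * c * (Z ∪ W).card := hdens.sum_card_neighborFinset_inter_le _
      _ ≤ k * (Z ∪ W).card := by gcongr
      _ ≤ k * (Z.card + W.card) := by
          gcongr
          exact_mod_cast Finset.card_union_le Z W
  have hk' : (2 : ℝ) ≤ k := by exact_mod_cast hk
  have hW' : 4 * (k : ℝ) ^ 3 + 1 ≤ W.card := by exact_mod_cast hW
  have hmul : (Z.card : ℝ) * (W.card - k - k ^ 2) ≤ k ^ 2 * W.card := by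
    have h := mul_le_mul_of_nonneg_left hsum (by linarith : (0 : ℝ) ≤ k)
    field_simp at h
    nlinarith
  by_contra! hlt
  have hlt' : 4 * (k : ℝ) ^ 2 ≤ Z.card := by
    have : (2 * (k : ℝ)) ^ 2 < Z.card := by exact_mod_cast hlt
    nlinarith
  have hkk : (k : ℝ) + k ^ 2 ≤ 2 * k ^ 3 := by
    nlinarith [mul_nonneg (sq_nonneg (k : ℝ)) (by linarith : (0 : ℝ) ≤ k - 2)]
  have hpos : (0 : ℝ) < W.card - 2 * (k + k ^ 2) := by linarith
  have hk2 : (0 : ℝ) < (k : ℝ) ^ 2 := by positivity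
  have hge := mul_le_mul_of_nonneg_right hlt'
    (by nlinarith : (0 : ℝ) ≤ W.card - k - k ^ 2)
  nlinarith [mul_pos hk2 hpos, mul_pos hk2 (by nlinarith : (0 : ℝ) < W.card)]

/-- A set containing every vertex of a list of length at most `m` each of whose entries is
strong for the part of `W` not dominated by the earlier entries. -/
noncomputable def strongReach [Fintype V] [DecidableEq V] (G : SimpleGraph V)
    [DecidableRel G.Adj] (α : ℝ) (ℓ : ℕ) : ℕ → Finset V → Finset V
  | 0, _ => ∅
  | m + 1, W => (strongVertices G α ℓ W).biUnion fun a =>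
      insert a (strongReach G α ℓ m (W \ closedNbhd G a))

theorem mem_strongReach [Fintype V] [DecidableEq V] {G : SimpleGraph V} [DecidableRel G.Adj]
    {α : ℝ} {ℓ m : ℕ} {W : Finset V} {L : List V} {u : V} (hm : L.length ≤ m)
    (hL : ∀ i (hi : i < L.length),
      L.get ⟨i, hi⟩ ∈ strongVertices G α ℓ (W \ ((L.take i).toFinset.biUnion (closedNbhd G))))
    (hu : u ∈ L) : u ∈ strongReach G α ℓ m W := by
  induction m generalizing W L with
  | zero => simp_all
  | succ m ih =>
    cases L with
    | nil => simp at hu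
    | cons a L =>
      rw [strongReach, Finset.mem_biUnion]
      refine ⟨a, by simpa using hL 0 (by simp), ?_⟩
      rw [Finset.mem_insert]
      refine (List.mem_cons.mp hu).imp_right fun h => ih (by simpa using hm) (fun i hi => ?_) h
      have h := hL (i + 1) (by simpa using hi)
      simpa [Finset.biUnion_insert, sdiff_sdiff_left] using h

theorem card_strongReach_add_two_le [Fintype V] [DecidableEq V] {G : SimpleGraph V}
    [DecidableRel G.Adj] {α : ℝ} {ℓ K : ℕ} (hK : 2 ≤ K)
    (h : ∀ W, (strongVertices G α ℓ W).card ≤ K) (m : ℕ) (W : Finset V) :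
    (strongReach G α ℓ m W).card + 2 ≤ 2 * K ^ m := by
  induction m generalizing W with
  | zero => simp [strongReach]
  | succ m ih =>
    have hcard : (strongReach G α ℓ (m + 1) W).card ≤ K * (2 * K ^ m - 1) := by
      refine (Finset.card_biUnion_le_card_mul _ _ (2 * K ^ m - 1) fun a _ => ?_).trans
        (Nat.mul_le_mul_right _ (h W))
      have h₁ := Finset.card_insert_le a (strongReach G α ℓ m (W \ closedNbhd G a))
      have h₂ := ih (W \ closedNbhd G a)
      omega
    have hpow : 1 ≤ K ^ m := Nat.one_le_pow _ _ (by omega)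
    rw [Nat.mul_sub, mul_one] at hcard
    have hle : K ≤ K * (2 * K ^ m) := Nat.le_mul_of_pos_right _ (by omega)
    have hpow_succ : 2 * K ^ (m + 1) = K * (2 * K ^ m) := by ring
    omega

theorem ncard_PCov_le [Fintype V] [DecidableEq V] {G : SimpleGraph V} [DecidableRel G.Adj]
    {c : ℝ} {k : ℕ} (hk : 2 ≤ k) (hkc : 2 * c ≤ (k : ℝ)) (hdens : DensityOneLE G c)
    (q : ℕ) (v : V) :
    (PCov G (1 / (k : ℝ)) (4 * k ^ 3 + 1) q k v).ncard ≤ (2 * k) ^ (2 * k + 1) := by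
  have hsub : PCov G (1 / (k : ℝ)) (4 * k ^ 3 + 1) q k v ⊆
      strongReach G (1 / (k : ℝ)) (4 * k ^ 3 + 1) k (G.neighborFinset v) := by
    rintro u ⟨-, L, ⟨hlen, -, hL⟩, hu⟩
    refine mem_strongReach hlen (fun i hi => ?_) hu
    rw [strongVertices, Finset.mem_filter]
    exact ⟨Finset.mem_univ _, hL i hi⟩
  have hle := Set.ncard_le_ncard hsub (Finset.finite_toSet _)
  rw [Set.ncard_coe_finset] at hle
  have hreach := card_strongReach_add_two_le (K := (2 * k) ^ 2) (by nlinarith)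
    (card_strongVertices_le hk hkc hdens) k (G.neighborFinset v)
  calc _ ≤ 2 * ((2 * k) ^ 2) ^ k := by omega
    _ ≤ (2 * k) * ((2 * k) ^ 2) ^ k := Nat.mul_le_mul_right _ (by omega)
    _ = (2 * k) ^ (2 * k + 1) := by rw [← pow_mul, pow_succ, mul_comm]

/-- under the assumptions of the algorithm (`K_{t,t}`-free, density `≤ c`,
`k ≥ 2`, `k ≥ 2c`, `D'` with the `k`-cover property), for every maximal
`k`-dominating-sequence `(v₁, …, v_s)` and every `1 ≤ i ≤ s - 1`:
`v_{i+1} ∈ 𝒫(v_i)`, `|N(v_i)| > ℓ` and `|𝒫(v_i)| ≤ (2k)^(2k+1)`. -/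
theorem stmt9 [Fintype V] [DecidableEq V] (G : SimpleGraph V) [DecidableRel G.Adj]
    (t k : ℕ) (ht : 1 ≤ t) (hk : 2 ≤ k)
    (c : ℝ) (hc : 0 < c) (hkc : 2 * c ≤ (k : ℝ)) (hdens : DensityOneLE G c)
    (hKtt : ¬ HasKtt G t)
    (D' : Finset V) (hD' : KCoverProp G D' k)
    (v : V) (s : ℕ) (vs : ℕ → V)
    (hmax : MaxKDomSeq G (1 / (k : ℝ)) (4 * k ^ 3 + 1) (4 * k ^ 4) k t v s vs) :
    ∀ i, 1 ≤ i → i + 1 ≤ s →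
      vs (i + 1) ∈ PCov G (1 / (k : ℝ)) (4 * k ^ 3 + 1) (4 * k ^ 4) k (vs i) ∧
      4 * k ^ 3 + 1 < (G.neighborFinset (vs i)).card ∧
      (PCov G (1 / (k : ℝ)) (4 * k ^ 3 + 1) (4 * k ^ 4) k (vs i)).ncard ≤
        (2 * k) ^ (2 * k + 1) := by
  intro i hi his
  obtain ⟨⟨-, -, -, B, -, -, -, hP⟩, -⟩ := hmax
  have hmem := hP (i + 1) (by omega) his
  rw [Nat.add_sub_cancel] at hmem
  exact ⟨hmem, hmem.1, ncard_PCov_le hk hkc hdens _ _⟩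
end

section
/- For all integers γ ≥ 1 and m ≥ 1 there exists a finite simple graph G such that: (1) G is 2-degenerate, i.e., every nonempty subgraph of G has a vertex of degree at most 2; (2) G has a dominating set of size γ; and (3) there are at least m distinct vertices w of G such that every set Z ⊆ V(G) ∖ {w} with N(w) ⊆ N[Z] satisfies |Z| ≥ γ. -/
open Finset

variable {V : Type*}

/-- The closed neighborhood `N[S]` of a set of vertices. -/
def NclosedSet (G : SimpleGraph V) (S : Set V) : Set V :=
  {w | ∃ u ∈ S, w = u ∨ G.Adj u w}

/-- If every vertex has at most two neighbors whose rank does not exceed its own, then the graph is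
2-degenerate. -/
theorem exists_ncard_neighborSet_le_two_of_rank {V : Type*} [Finite V] {G : SimpleGraph V}
    (f : V → ℕ) (hf : ∀ v, ∃ a b, ∀ u, G.Adj v u → f u ≤ f v → u = a ∨ u = b)
    (H : G.Subgraph) (hH : H.verts.Nonempty) : ∃ v ∈ H.verts, (H.neighborSet v).ncard ≤ 2 := by
  obtain ⟨v, hv, hmax⟩ := Set.exists_max_image H.verts f (Set.toFinite _) hH
  obtain ⟨a, b, hab⟩ := hf v
  refine ⟨v, hv, ?_⟩
  have hsub : H.neighborSet v ⊆ {a, b} := fun u hu => hab u hu.adj_sub (hmax u hu.snd_mem)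
  exact (Set.ncard_le_ncard hsub (Set.toFinite _)).trans
    ((Set.ncard_insert_le a {b}).trans (by simp))

/-- The vertices of the spoke graph: `n` hubs, `m` centers, and one spoke for each pair consisting
of a center and a hub. -/
inductive SpokeVertex (n m : ℕ) : Type
  | hub (i : Fin n)
  | center (j : Fin m)
  | spoke (j : Fin m) (i : Fin n)

namespace SpokeVertex

variable {n m : ℕ}

instance : Finite (SpokeVertex n m) :=
  Finite.of_surjective
    (Sum.elim hub (Sum.elim center fun p => spoke p.1 p.2) :
      Fin n ⊕ Fin m ⊕ Fin m × Fin n → SpokeVertex n m)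
    (by
      rintro (i | j | ⟨j, i⟩)
      · exact ⟨.inl i, rfl⟩
      · exact ⟨.inr (.inl j), rfl⟩
      · exact ⟨.inr (.inr (j, i)), rfl⟩)

/-- Each spoke is joined to its center and its hub, and each center is joined to the hub `i₀`. -/
def Joins (i₀ : Fin n) : SpokeVertex n m → SpokeVertex n m → Prop
  | center _, hub i => i = i₀
  | spoke _ i, hub i' => i' = i
  | spoke j _, center j' => j' = j
  | _, _ => False

/-- The spoke graph. -/
def graph (m : ℕ) (i₀ : Fin n) : SimpleGraph (SpokeVertex n m) where
  Adj u v := Joins i₀ u v ∨ Joins i₀ v u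
  symm := ⟨fun _ _ => Or.symm⟩
  loopless := ⟨by rintro (_ | _ | _) <;> simp [Joins]⟩

/-- The elimination rank: spokes are removed first, then centers, then hubs. -/
def rank : SpokeVertex n m → ℕ
  | hub _ => 0
  | center _ => 1
  | spoke _ _ => 2

theorem exists_lower_neighbors (i₀ : Fin n) (v : SpokeVertex n m) :
    ∃ a b, ∀ u, (graph m i₀).Adj v u → rank u ≤ rank v → u = a ∨ u = b := by
  rcases v with i | j | ⟨j, i⟩
  · refine ⟨hub i, hub i, ?_⟩
    rintro (_ | _ | _) <;> simp [graph, Joins, rank]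
  · refine ⟨hub i₀, hub i₀, ?_⟩
    rintro (_ | _ | _) <;> simp [graph, Joins, rank]
  · refine ⟨hub i, center j, ?_⟩
    rintro (_ | _ | _) <;> simp +contextual [graph, Joins]

theorem hubs_dominate (i₀ : Fin n) (v : SpokeVertex n m) :
    ∃ d ∈ Set.range hub, d = v ∨ (graph m i₀).Adj d v := by
  rcases v with i | j | ⟨j, i⟩
  · exact ⟨_, ⟨i, rfl⟩, .inl rfl⟩
  · exact ⟨_, ⟨i₀, rfl⟩, .inr (.inr rfl)⟩
  · exact ⟨_, ⟨i, rfl⟩, .inr (.inr rfl)⟩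

theorem le_ncard_of_dominates_neighborSet_center (i₀ : Fin n) (j : Fin m)
    (Z : Set (SpokeVertex n m)) (hj : center j ∉ Z)
    (hZ : (graph m i₀).neighborSet (center j) ⊆ NclosedSet (graph m i₀) Z) : n ≤ Z.ncard := by
  have h : ∀ i, ∃ u ∈ Z, u = spoke j i ∨ u = hub i := by
    intro i
    obtain ⟨u, hu, h⟩ := hZ (show (graph m i₀).Adj (center j) (spoke j i) from .inr rfl)
    refine ⟨u, hu, h.imp Eq.symm fun hadj => ?_⟩
    rcases u with i' | j' | _ <;> simp only [graph, Joins, or_false, false_or] at hadj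
    · rw [hadj]
    · exact absurd (hadj ▸ hu) hj
  choose g hgZ hg using h
  have hinj : Function.Injective g := by
    intro i i' hii'
    rcases hg i with h | h <;> rcases hg i' with h' | h' <;> simp_all
  calc n = (Set.range g).ncard := by simp [Set.ncard_range_of_injective hinj]
    _ ≤ Z.ncard := Set.ncard_le_ncard (Set.range_subset_iff.2 hgZ) (Set.toFinite _)

end SpokeVertex

/-- for all `γ, m ≥ 1` there is a finite 2-degenerate graph `G` with a
dominating set of size `γ` and at least `m` vertices `w` such that every
`Z ⊆ V(G) \\ {w}` dominating `N(w)` has `|Z| ≥ γ`. -/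
theorem stmt15 (γ m : ℕ) (hγ : 1 ≤ γ) (hm : 1 ≤ m) :
    ∃ (V : Type) (_ : Fintype V) (G : SimpleGraph V),
      (∀ H : G.Subgraph, H.verts.Nonempty → ∃ v ∈ H.verts, (H.neighborSet v).ncard ≤ 2) ∧
      (∃ D : Set V, (∀ v : V, ∃ d ∈ D, d = v ∨ G.Adj d v) ∧ D.ncard = γ) ∧
      (∃ S : Set V, m ≤ S.ncard ∧ ∀ w ∈ S, ∀ Z : Set V, w ∉ Z →
        G.neighborSet w ⊆ NclosedSet G Z → γ ≤ Z.ncard) := by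
  let i₀ : Fin γ := ⟨0, hγ⟩
  refine ⟨SpokeVertex γ m, Fintype.ofFinite _, SpokeVertex.graph m i₀,
    exists_ncard_neighborSet_le_two_of_rank _ (SpokeVertex.exists_lower_neighbors i₀),
    ⟨Set.range SpokeVertex.hub, SpokeVertex.hubs_dominate i₀, ?_⟩,
    Set.range SpokeVertex.center, ?_, ?_⟩
  · rw [Set.ncard_range_of_injective fun _ _ h => SpokeVertex.hub.inj h, Nat.card_fin]
  · rw [Set.ncard_range_of_injective fun _ _ h => SpokeVertex.center.inj h, Nat.card_fin]
  · rintro _ ⟨j, rfl⟩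
    exact SpokeVertex.le_ncard_of_dominates_neighborSet_center i₀ j
end
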